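/- arXiv:2302.03789 — 4 statements merged into one kernel-verified Lean document; each statement's English description precedes it below -/
import Mathlib

section
/- Let M = (S, A, s0, P) be a reward-free MDP satisfying the RESET assumption and let L ≥ 1 be a real number. Then every fixed point of the state-expansion operator contains the incrementally L-controllable states: for every subset X ⊆ S with T_L(X) = X, one has S→_L ⊆ X. -/
open scoped ENNReal Classical

/-- A reward-free MDP with countable state space `S`, action space `A` containing a
distinguished `RESET` action, initial state `s0`, and transition kernel `P`,
satisfying the RESET assumption. -/
structure RFMDP (S : Type) (A : Type) where
  s0 : S
  reset : A
  P : S → A → PMF S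
  reset_eq : ∀ s : S, P s reset s0 = 1

namespace RFMDP

variable {S A : Type}

/-- `survive M π g n s` is the probability that the Markov chain started at `s` and
following policy `π` has not yet hit the goal `g` within the first `n+1` visited states,
i.e. `P(T > n)` where `T = inf {i ≥ 0 : s_{i+1} = g}` and `s_1 = s`. -/
noncomputable def survive (M : RFMDP S A) (π : S → A) (g : S) : ℕ → S → ℝ≥0∞
  | 0, s => if s = g then 0 else 1
  | n + 1, s => if s = g then 0 else ∑' s' : S, M.P s (π s) s' * survive M π g n s'

/-- The value `V^π_g(s)`: the expected hitting time of the goal `g` starting from `s`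
and following policy `π` (`+∞` if `g` is almost surely unreachable), computed as
`E[T] = Σ_{n ≥ 0} P(T > n)`. -/
noncomputable def V (M : RFMDP S A) (π : S → A) (g s : S) : ℝ≥0∞ :=
  ∑' n : ℕ, M.survive π g n s

/-- The set `Π(X)` of policies restricted on `X`: those playing `RESET` outside `X`. -/
def restrictedPolicies (M : RFMDP S A) (X : Set S) : Set (S → A) :=
  {π | ∀ s ∉ X, π s = M.reset}

/-- `V*_{X,g}(s)`: the optimal hitting time of `g` from `s` over policies restricted on `X`. -/
noncomputable def Vstar (M : RFMDP S A) (X : Set S) (g s : S) : ℝ≥0∞ :=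
  ⨅ π ∈ M.restrictedPolicies X, M.V π g s

/-- The state-expansion operator `T_L`. -/
def TL (M : RFMDP S A) (L : ℝ) (X : Set S) : Set S :=
  {s | M.Vstar X s M.s0 ≤ ENNReal.ofReal L}

/-- `S_L^≺`: the least subset of `S` containing `s0` and closed under adding any state `s`
reachable in at most `L` expected steps from `s0` by a policy restricted on
`{s' ∈ S_L^≺ : s' ≺ s}`. -/
def SLprec (M : RFMDP S A) (L : ℝ) (prec : S → S → Prop) : Set S :=
  sInf {X : Set S | M.s0 ∈ X ∧
    ∀ s : S, (∃ π ∈ M.restrictedPolicies {s' ∈ X | prec s' s},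
      M.V π s M.s0 ≤ ENNReal.ofReal L) → s ∈ X}

/-- The set `S→_L` of incrementally `L`-controllable states: the union of `S_L^≺` over
all (strict) partial orders `≺` on `S`. -/
def SLarrow (M : RFMDP S A) (L : ℝ) : Set S :=
  ⋃ (prec : S → S → Prop) (_ : IsStrictOrder S prec), M.SLprec L prec

/-- The layer sequence: `layer 0 = {s0} = K*_1` and `layer (n+1) = T_L (layer n) = K*_{n+2}`. -/
noncomputable def layer (M : RFMDP S A) (L : ℝ) : ℕ → Set S
  | 0 => {M.s0}
  | n + 1 => M.TL L (M.layer L n)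

theorem V_self (M : RFMDP S A) (π : S → A) (g : S) : M.V π g g = 0 := by
  refine ENNReal.tsum_eq_zero.mpr fun n => ?_
  cases n <;> simp [survive]

theorem mem_TL_of_V_le (M : RFMDP S A) {L : ℝ} {X : Set S} {π : S → A} {s : S}
    (hπ : π ∈ M.restrictedPolicies X) (h : M.V π s M.s0 ≤ ENNReal.ofReal L) :
    s ∈ M.TL L X :=
  show M.Vstar X s M.s0 ≤ ENNReal.ofReal L from
    (iInf₂_le (f := fun π _ => M.V π s M.s0) π hπ).trans h

theorem restrictedPolicies_mono (M : RFMDP S A) {X Y : Set S} (h : X ⊆ Y) :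
    M.restrictedPolicies X ⊆ M.restrictedPolicies Y :=
  fun _ hπ s hs => hπ s fun hX => hs (h hX)

theorem s0_mem_TL (M : RFMDP S A) (L : ℝ) (X : Set S) : M.s0 ∈ M.TL L X :=
  M.mem_TL_of_V_le (π := fun _ => M.reset) (fun _ _ => rfl) (by simp [V_self])

theorem SLprec_subset_of_TL_subset (M : RFMDP S A) {L : ℝ} {X : Set S}
    (hX : M.TL L X ⊆ X) (prec : S → S → Prop) : M.SLprec L prec ⊆ X :=
  sInf_le ⟨hX (M.s0_mem_TL L X), fun _ ⟨_, hπ, hV⟩ =>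
    hX (M.mem_TL_of_V_le (M.restrictedPolicies_mono (Set.sep_subset _ _) hπ) hV)⟩

end RFMDP

/-- every fixed point of the state-expansion operator `T_L` contains the
set of incrementally `L`-controllable states. -/
theorem fixed_point_contains_SLarrow
    {S A : Type} [Countable S] [Finite A] (M : RFMDP S A) (L : ℝ) (hL : 1 ≤ L)
    (X : Set S) (hX : M.TL L X = X) : M.SLarrow L ⊆ X :=
  Set.iUnion₂_subset fun prec _ => M.SLprec_subset_of_TL_subset hX.subset prec
end

section
/- Let M = (S, A, s0, P) be a reward-free MDP satisfying the RESET assumption and let L ≥ 1 be a real number. Then every incrementally L-controllable state is reachable in at most L expected steps by a policy restricted on S→_L: for every s ∈ S→_L, V*_{S→_L, s}(s0) ≤ L. -/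
open scoped ENNReal Classical

namespace RFMDP

variable {S A : Type}

theorem Vstar_le (M : RFMDP S A) {X : Set S} {π : S → A} (hπ : π ∈ M.restrictedPolicies X)
    (g s : S) : M.Vstar X g s ≤ M.V π g s :=
  iInf₂_le π hπ

theorem Vstar_self (M : RFMDP S A) (X : Set S) (g : S) : M.Vstar X g g = 0 := by
  have hreset : (fun _ => M.reset) ∈ M.restrictedPolicies X := fun _ _ => rfl
  exact le_antisymm ((M.Vstar_le hreset g g).trans_eq (M.V_self _ g)) zero_le

/-- `S_L^≺` is a fixed point of the monotone operator whose least closed set it is: each of its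
states other than `s0` is added by a policy restricted on its predecessors in `S_L^≺`. -/
theorem eq_s0_or_exists_of_mem_SLprec (M : RFMDP S A) {L : ℝ} {prec : S → S → Prop} {s : S}
    (hs : s ∈ M.SLprec L prec) :
    s = M.s0 ∨ ∃ π ∈ M.restrictedPolicies {s' ∈ M.SLprec L prec | prec s' s},
      M.V π s M.s0 ≤ ENNReal.ofReal L := by
  refine Set.mem_sInter.1 hs {t | t = M.s0 ∨
    ∃ π ∈ M.restrictedPolicies {s' ∈ M.SLprec L prec | prec s' t},
      M.V π t M.s0 ≤ ENNReal.ofReal L} ⟨Or.inl rfl, ?_⟩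
  rintro t ⟨π, hπ, hV⟩
  refine Or.inr ⟨π, M.restrictedPolicies_mono ?_ hπ, hV⟩
  rintro u ⟨rfl | ⟨ρ, hρ, hρV⟩, hut⟩
  · exact ⟨Set.mem_sInter.2 fun _ hX => hX.1, hut⟩
  · refine ⟨Set.mem_sInter.2 fun X hX => hX.2 u ⟨ρ, M.restrictedPolicies_mono ?_ hρ, hρV⟩, hut⟩
    exact fun v hv => ⟨Set.mem_sInter.1 hv.1 X hX, hv.2⟩

theorem SLprec_subset_SLarrow (M : RFMDP S A) (L : ℝ) (prec : S → S → Prop)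
    (h : IsStrictOrder S prec) : M.SLprec L prec ⊆ M.SLarrow L :=
  Set.subset_iUnion₂_of_subset prec h subset_rfl

end RFMDP

/-- every incrementally `L`-controllable state is reachable in at most `L`
expected steps from `s0` by a policy restricted on `S→_L`. -/
theorem SLarrow_mem_controllable
    {S A : Type} [Countable S] [Finite A] (M : RFMDP S A) (L : ℝ) (hL : 1 ≤ L) :
    ∀ s ∈ M.SLarrow L, M.Vstar (M.SLarrow L) s M.s0 ≤ ENNReal.ofReal L := by
  intro s hs
  obtain ⟨prec, hprec, hs⟩ := Set.mem_iUnion₂.1 hs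
  obtain rfl | ⟨π, hπ, hV⟩ := M.eq_s0_or_exists_of_mem_SLprec hs
  · exact (M.Vstar_self _ _).trans_le zero_le
  · refine (M.Vstar_le (M.restrictedPolicies_mono ?_ hπ) s M.s0).trans hV
    exact fun u hu => M.SLprec_subset_SLarrow L prec hprec hu.1
end

section
/- Let M = (S, A, s0, P) be a reward-free MDP satisfying the RESET assumption and let L ≥ 1 be a real number. Let X ⊆ S be nonempty and let g ∈ S \ X satisfy V*_{X,g}(s0) ≤ L. Then there exist s ∈ X and a ∈ A with P_{s,a}(g) ≥ 1/(2L). Equivalently, for nonempty X, T_L(X) \ X ⊆ N(X, 1/(2L)), where N(X, p) = {s' ∉ X : P_{s,a}(s') ≥ p for some (s,a) ∈ X × A}. -/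
open scoped ENNReal Classical

namespace RFMDP

/-- If the one-step probability of hitting `g` is at most `p` from every state other than `g`,
then `g` has not been hit after `n` steps with probability at least `(1 - p) ^ n`. -/
theorem one_sub_pow_le_survive {S A : Type} (M : RFMDP S A) (π : S → A) (g : S) (p : ℝ≥0∞)
    (h : ∀ s, s ≠ g → M.P s (π s) g ≤ p) (n : ℕ) (s : S) (hs : s ≠ g) :
    (1 - p) ^ n ≤ M.survive π g n s := by
  induction n generalizing s with
  | zero => simp [survive, hs]
  | succ n ih =>
    rw [survive, if_neg hs]
    have hsum : 1 - p ≤ ∑' s', (if s' = g then 0 else M.P s (π s) s') := by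
      rw [tsub_le_iff_left, ← (M.P s (π s)).tsum_coe, ENNReal.tsum_eq_add_tsum_ite g]
      gcongr
      exact h s hs
    calc (1 - p) ^ (n + 1) = (1 - p) * (1 - p) ^ n := pow_succ' _ _
      _ ≤ (∑' s', (if s' = g then 0 else M.P s (π s) s')) * (1 - p) ^ n := by gcongr
      _ = ∑' s', (if s' = g then 0 else M.P s (π s) s') * (1 - p) ^ n := ENNReal.tsum_mul_right.symm
      _ ≤ ∑' s', M.P s (π s) s' * M.survive π g n s' := by
        refine ENNReal.tsum_le_tsum fun s' => ?_
        split_ifs with hs'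
        · simp
        · gcongr
          exact ih s' hs'

/-- If the one-step probability of hitting `g` is at most `p ≤ 1` from every state other than `g`,
then the expected hitting time of `g` is at least `1 / p`. -/
theorem inv_le_V {S A : Type} (M : RFMDP S A) (π : S → A) (g : S) (p : ℝ≥0∞) (hp : p ≤ 1)
    (h : ∀ s, s ≠ g → M.P s (π s) g ≤ p) (s : S) (hs : s ≠ g) :
    p⁻¹ ≤ M.V π g s := by
  calc p⁻¹ = ∑' n : ℕ, (1 - p) ^ n := by
        rw [ENNReal.tsum_geometric, ENNReal.sub_sub_cancel ENNReal.one_ne_top hp]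
    _ ≤ M.V π g s :=
        ENNReal.tsum_le_tsum fun n => M.one_sub_pow_le_survive π g p h n s hs

/-- `RESET` never leads to a state other than `s0`. -/
theorem P_reset_of_ne {S A : Type} (M : RFMDP S A) (s : S) {g : S} (hg : M.s0 ≠ g) :
    M.P s M.reset g = 0 := by
  rw [PMF.apply_eq_zero_iff, (PMF.apply_eq_one_iff _ _).1 (M.reset_eq s)]
  exact fun h => hg h.symm

end RFMDP

/-- if `X` is nonempty, `g ∉ X` and `V*_{X,g}(s0) ≤ L`, then some state of
`X` has an action whose transition probability to `g` is at least `1/(2L)`; i.e.,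
`T_L(X) \ X ⊆ N(X, 1/(2L))`. -/
theorem reachable_goal_has_large_transition
    {S A : Type} [Countable S] [Finite A] (M : RFMDP S A) (L : ℝ) (hL : 1 ≤ L)
    (X : Set S) (hX : X.Nonempty) (g : S) (hg : g ∉ X)
    (hV : M.Vstar X g M.s0 ≤ ENNReal.ofReal L) :
    ∃ s ∈ X, ∃ a : A, ENNReal.ofReal (1 / (2 * L)) ≤ M.P s a g := by
  have hp : ENNReal.ofReal (1 / (2 * L)) ≤ 1 := by
    rw [ENNReal.ofReal_le_one, div_le_one (by positivity)]
    linarith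
  by_cases h0 : M.s0 = g
  · obtain ⟨s, hs⟩ := hX
    refine ⟨s, hs, M.reset, ?_⟩
    rwa [← h0, M.reset_eq]
  by_contra! hlt
  have hge : ENNReal.ofReal (2 * L) ≤ M.Vstar X g M.s0 := by
    refine le_iInf₂ fun π hπ => ?_
    have hstep : ∀ s, s ≠ g → M.P s (π s) g ≤ ENNReal.ofReal (1 / (2 * L)) := by
      intro s _
      by_cases hs : s ∈ X
      · exact (hlt s hs (π s)).le
      · rw [hπ s hs, M.P_reset_of_ne s h0]
        exact zero_le
    have := M.inv_le_V π g _ hp hstep M.s0 h0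
    rwa [one_div, ENNReal.ofReal_inv_of_pos (by positivity), inv_inv] at this
  have := (ENNReal.ofReal_le_ofReal_iff (by positivity)).1 (hge.trans hV)
  linarith
end

section
/- Let p ≥ 1 be a real number. There exists a constant C_p > 0, depending only on p, with the following property: for all reals a, b, c ≥ 0, d > 0 and x ≥ 0 such that d·x ≥ e, if x ≤ a·sqrt(x·(ln(d·x))^p) + b·(ln(d·x))^p + c, then x ≤ C_p · ((a^2 + b)·(ln(e + (a + b + c)·(d + 1)))^p + c). -/
/-- A term `a * √(x * w)` with `x, w ≥ 0` can be absorbed into the left-hand side. -/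
theorem le_two_mul_of_le_mul_sqrt_add {a b c x w : ℝ} (hx : 0 ≤ x)
    (hw : 0 ≤ w) (h : x ≤ a * Real.sqrt (x * w) + b * w + c) :
    x ≤ 2 * ((a ^ 2 + b) * w + c) := by
  rw [Real.sqrt_mul hx] at h
  have hxs := Real.sq_sqrt hx
  have hws := Real.sq_sqrt hw
  have hsq := sq_nonneg (Real.sqrt x - a * Real.sqrt w)
  have haw : 0 ≤ a ^ 2 * w := by positivity
  have hexp : (Real.sqrt x - a * Real.sqrt w) ^ 2
      = x - 2 * (a * (Real.sqrt x * Real.sqrt w)) + a ^ 2 * w := by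
    rw [← hxs, ← hws, Real.sqrt_sq (Real.sqrt_nonneg x), Real.sqrt_sq (Real.sqrt_nonneg w)]
    ring
  linarith

/-- If `y ≤ A * T ^ 2 * (log y) ^ p`, then `log y` is at most a constant multiple of `log T`. -/
theorem log_le_mul_log_of_le_mul_log_rpow {p A y T : ℝ} (hp : 1 ≤ p) (hA : 1 ≤ A)
    (hy : Real.exp 1 ≤ y) (hT : Real.exp 1 ≤ T) (h : y ≤ A * T ^ 2 * Real.log y ^ p) :
    Real.log y ≤ (2 * Real.log A + 4 + 2 * (p * Real.log (2 * p))) * Real.log T := by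
  have hy0 : 0 < y := (Real.exp_pos 1).trans_le hy
  have hT0 : 0 < T := (Real.exp_pos 1).trans_le hT
  have hL : 1 ≤ Real.log y := (Real.le_log_iff_exp_le hy0).2 hy
  have hM : 1 ≤ Real.log T := (Real.le_log_iff_exp_le hT0).2 hT
  have hL0 : 0 < Real.log y := by linarith
  have hA0 : 0 < A := by linarith
  have hp0 : 0 < p := by linarith
  have hlog := Real.log_le_log hy0 h
  rw [Real.log_mul (by positivity) (by positivity), Real.log_mul (by positivity) (by positivity),
    Real.log_pow, Real.log_rpow hL0] at hlog
  push_cast at hlog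
  have hdiv := Real.log_le_sub_one_of_pos (show 0 < Real.log y / (2 * p) by positivity)
  rw [Real.log_div hL0.ne' (by positivity)] at hdiv
  have hmul := mul_le_mul_of_nonneg_left hdiv hp0.le
  have hcancel : p * (Real.log y / (2 * p) - 1) = Real.log y / 2 - p := by
    field_simp
  have hlogA : 0 ≤ Real.log A := Real.log_nonneg hA
  have hlogp : 0 ≤ p * Real.log (2 * p) :=
    mul_nonneg hp0.le (Real.log_nonneg (by linarith))
  nlinarith [mul_nonneg hlogA (sub_nonneg.2 hM), mul_nonneg hlogp (sub_nonneg.2 hM)]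


/-- solving the self-referential logarithmic inequality.  For every real
`p ≥ 1` there is a constant `C_p > 0` such that for all `a,b,c ≥ 0`, `d > 0`, `x ≥ 0`
with `d·x ≥ e`, if `x ≤ a·√(x·(ln(dx))^p) + b·(ln(dx))^p + c` then
`x ≤ C_p·((a² + b)·(ln(e + (a+b+c)·(d+1)))^p + c)`. -/
theorem solve_log_quadratic_inequality (p : ℝ) (hp : 1 ≤ p) :
    ∃ C : ℝ, 0 < C ∧
      ∀ a b c d x : ℝ, 0 ≤ a → 0 ≤ b → 0 ≤ c → 0 < d → 0 ≤ x →
        Real.exp 1 ≤ d * x →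
        x ≤ a * Real.sqrt (x * Real.log (d * x) ^ p) + b * Real.log (d * x) ^ p + c →
        x ≤ C * ((a ^ 2 + b) * Real.log (Real.exp 1 + (a + b + c) * (d + 1)) ^ p + c) := by
  set K : ℝ := 2 * Real.log 6 + 4 + 2 * (p * Real.log (2 * p)) with hK
  have hK0 : 0 ≤ K := by
    have h6 : 0 ≤ Real.log 6 := Real.log_nonneg (by norm_num)
    have h2p : 0 ≤ Real.log (2 * p) := Real.log_nonneg (by linarith)
    positivity
  have hKp : 0 ≤ K ^ p := Real.rpow_nonneg hK0 p
  refine ⟨2 * (K ^ p + 1), by positivity, ?_⟩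
  intro a b c d x ha hb hc hd hx hdx h
  set T : ℝ := Real.exp 1 + (a + b + c) * (d + 1) with hT
  have he : 1 ≤ Real.exp 1 := Real.one_le_exp zero_le_one
  have heT : Real.exp 1 ≤ T := by
    rw [hT]
    have : 0 ≤ (a + b + c) * (d + 1) := by positivity
    linarith
  have hT1 : 1 ≤ T := he.trans heT
  have hL : 1 ≤ Real.log (d * x) :=
    (Real.le_log_iff_exp_le ((Real.exp_pos 1).trans_le hdx)).2 hdx
  have hM : 0 ≤ Real.log T := Real.log_nonneg hT1
  have hLp : 1 ≤ Real.log (d * x) ^ p := Real.one_le_rpow hL (by linarith)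
  have hquad := le_two_mul_of_le_mul_sqrt_add hx (by linarith) h
  have had : a * (d + 1) ≤ T := by
    have : 0 ≤ (b + c) * (d + 1) := by positivity
    rw [hT]; linarith
  have hbd : d * b ≤ T := by
    have : 0 ≤ a * (d + 1) + b + c * (d + 1) := by positivity
    rw [hT]; linarith
  have hcd : d * c ≤ T := by
    have : 0 ≤ a * (d + 1) + c + b * (d + 1) := by positivity
    rw [hT]; linarith
  have hTT : T ≤ T ^ 2 := by nlinarith
  have hasq : d * a ^ 2 ≤ T ^ 2 := by
    have hpow : (a * (d + 1)) ^ 2 ≤ T ^ 2 := by gcongr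
    have : 0 ≤ a ^ 2 * (d ^ 2 + d + 1) := by positivity
    linarith
  have hy : d * x ≤ 6 * T ^ 2 * Real.log (d * x) ^ p := by
    calc d * x ≤ d * (2 * ((a ^ 2 + b) * Real.log (d * x) ^ p + c)) := by gcongr
      _ = 2 * ((d * a ^ 2 + d * b) * Real.log (d * x) ^ p + d * c) := by ring
      _ ≤ 2 * ((T ^ 2 + T ^ 2) * Real.log (d * x) ^ p + T ^ 2 * Real.log (d * x) ^ p) := by
        have hc' : d * c ≤ T ^ 2 * Real.log (d * x) ^ p :=
          (hcd.trans hTT).trans (le_mul_of_one_le_right (sq_nonneg T) hLp)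
        have hb' := hbd.trans hTT
        gcongr
      _ = 6 * T ^ 2 * Real.log (d * x) ^ p := by ring
  have hLM : Real.log (d * x) ≤ K * Real.log T :=
    log_le_mul_log_of_le_mul_log_rpow hp (by norm_num) hdx heT hy
  have hpow : Real.log (d * x) ^ p ≤ K ^ p * Real.log T ^ p := by
    rw [← Real.mul_rpow hK0 hM]
    exact Real.rpow_le_rpow (by linarith) hLM (by linarith)
  have hMp : 0 ≤ Real.log T ^ p := Real.rpow_nonneg hM p
  calc x ≤ 2 * ((a ^ 2 + b) * Real.log (d * x) ^ p + c) := hquad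
    _ ≤ 2 * ((a ^ 2 + b) * (K ^ p * Real.log T ^ p) + c) := by gcongr
    _ ≤ 2 * (K ^ p + 1) * ((a ^ 2 + b) * Real.log T ^ p + c) := by
      have h1 : 0 ≤ (a ^ 2 + b) * Real.log T ^ p := by positivity
      have h2 : 0 ≤ K ^ p * c := by positivity
      linarith
end
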